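/- Let E be a uniformly smooth Banach space and p ∈ (1,∞). Then the function x ↦ ‖x‖_E^p is continuously differentiable (C¹) on the whole space E. -/

import Mathlib

open MeasureTheory Set Filter Topology

noncomputable section

/-- A uniformly smooth normed space: the norm is uniformly Fréchet differentiable away
from `0`, expressed through the vanishing of the modulus of smoothness. -/
def UniformlySmooth (E : Type*) [NormedAddCommGroup E] [NormedSpace ℝ E] : Prop :=
  ∀ ε > (0:ℝ), ∃ δ > (0:ℝ), ∀ x y : E, ‖x‖ = 1 → ‖y‖ ≤ δ →
    ‖x + y‖ + ‖x - y‖ - 2 ≤ ε * ‖y‖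

/-- In a uniformly smooth space, every norming functional of `x ≠ 0` is the Fréchet derivative
of the norm at `x`. -/
theorem UniformlySmooth.hasFDerivAt_norm {E : Type*} [NormedAddCommGroup E] [NormedSpace ℝ E]
    (hE : UniformlySmooth E) {x : E} (hx : x ≠ 0) {f : E →L[ℝ] ℝ} (hf : ‖f‖ ≤ 1)
    (hfx : f x = ‖x‖) : HasFDerivAt (fun y : E => ‖y‖) f x := by
  have hle : ∀ y, f y ≤ ‖y‖ := fun y => (le_abs_self _).trans (f.le_of_opNorm_le_of_le hf le_rfl
    |>.trans_eq (one_mul _))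
  have hpos : 0 < ‖x‖ := norm_pos_iff.2 hx
  rw [hasFDerivAt_iff_isLittleO_nhds_zero, Asymptotics.isLittleO_iff]
  intro ε hε
  obtain ⟨δ, hδ, h⟩ := hE ε hε
  filter_upwards [Metric.closedBall_mem_nhds (0 : E) (mul_pos hδ hpos)] with y hy
  rw [mem_closedBall_zero_iff] at hy
  have hscale : ∀ z : E, ‖‖x‖⁻¹ • z‖ = ‖x‖⁻¹ * ‖z‖ := fun z => by
    rw [norm_smul, norm_inv, norm_norm]
  have key := h (‖x‖⁻¹ • x) (‖x‖⁻¹ • y) (by rw [hscale, inv_mul_cancel₀ hpos.ne'])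
    (by rw [hscale, inv_mul_le_iff₀ hpos]; linarith)
  rw [← smul_add, ← smul_sub, hscale, hscale, hscale] at key
  have key' : ‖x + y‖ + ‖x - y‖ - 2 * ‖x‖ ≤ ε * ‖y‖ := by
    have := mul_le_mul_of_nonneg_left key hpos.le
    field_simp at this
    linarith
  have h₁ := hle (x + y)
  have h₂ := hle (x - y)
  rw [map_add, hfx] at h₁
  rw [map_sub, hfx] at h₂
  rw [Real.norm_eq_abs, abs_le]
  constructor <;> nlinarith [norm_nonneg y]

/-- A selection of norming functionals is continuous at every point where it is the derivative
of the norm. -/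
theorem continuousAt_of_hasFDerivAt_norm {E : Type*} [NormedAddCommGroup E] [NormedSpace ℝ E]
    {f : E → E →L[ℝ] ℝ} (hf : ∀ x, ‖f x‖ ≤ 1) (hfx : ∀ x, f x x = ‖x‖) {x : E}
    (h : HasFDerivAt (fun y : E => ‖y‖) (f x) x) : ContinuousAt f x := by
  have hle : ∀ x y, f x y ≤ ‖y‖ := fun x y => (le_abs_self _).trans
    ((f x).le_of_opNorm_le_of_le (hf x) le_rfl |>.trans_eq (one_mul _))
  rw [Metric.continuousAt_iff']
  intro ε hε
  rw [hasFDerivAt_iff_isLittleO_nhds_zero, Asymptotics.isLittleO_iff] at h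
  obtain ⟨r, hr, hball⟩ := Metric.eventually_nhds_iff_ball.1 (h (show 0 < ε / 8 by positivity))
  filter_upwards [Metric.ball_mem_nhds x (half_pos hr)] with z hz
  rw [mem_ball_iff_norm] at hz
  have hsub : ∀ y : E, ‖y‖ < r / 2 → f z y - f x y ≤ ε / 8 * r := by
    intro y hy
    have hlt : ‖z - x + y‖ < r := (norm_add_le _ _).trans_lt (by linarith)
    have hb := (le_abs_self _).trans (hball (z - x + y) (by simpa using hlt))
    have h₁ := hle z (z + y)
    have h₂ := hle x z
    rw [map_add, hfx] at h₁
    rw [show x + (z - x + y) = z + y by abel, map_add, map_sub, hfx] at hb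
    nlinarith
  have hnorm : ‖f z - f x‖ ≤ ε / 2 := by
    refine ContinuousLinearMap.opNorm_le_of_shell (c := (2 : ℝ)) (half_pos hr) (by positivity)
      (by norm_num) fun y hy₁ hy₂ => ?_
    have h₁ := hsub y hy₂
    have h₂ := hsub (-y) (by rwa [norm_neg])
    rw [map_neg, map_neg] at h₂
    rw [Real.norm_eq_abs] at hy₁
    norm_num at hy₁
    rw [sub_apply, Real.norm_eq_abs, abs_le]
    constructor <;> nlinarith
  rw [dist_eq_norm]
  linarith

theorem hasFDerivAt_zero_norm_rpow {E : Type*} [NormedAddCommGroup E] [NormedSpace ℝ E]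
    {p : ℝ} (hp : 1 < p) : HasFDerivAt (fun x : E => ‖x‖ ^ p) (0 : E →L[ℝ] ℝ) 0 := by
  have hp' : 0 < p - 1 := sub_pos.2 hp
  rw [hasFDerivAt_iff_isLittleO_nhds_zero, Asymptotics.isLittleO_iff]
  intro ε hε
  have ht : Tendsto (fun x : E => ‖x‖ ^ (p - 1)) (𝓝 0) (𝓝 0) := by
    simpa [Real.zero_rpow hp'.ne'] using
      (continuous_norm.rpow_const (fun _ : E => Or.inr hp'.le)).tendsto 0
  filter_upwards [ht.eventually_le_const hε] with y hy
  have hsplit : ‖y‖ ^ p = ‖y‖ ^ (p - 1) * ‖y‖ := by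
    rw [← Real.rpow_add_one' (norm_nonneg y) (by linarith), sub_add_cancel]
  rw [zero_add, norm_zero, Real.zero_rpow (by linarith), sub_zero, zero_apply, sub_zero,
    Real.norm_of_nonneg (by positivity), hsplit]
  exact mul_le_mul_of_nonneg_right hy (norm_nonneg y)

/-- In a uniformly smooth Banach space `E`, for every exponent `p ∈ (1,∞)` the function
`x ↦ ‖x‖^p` is continuously differentiable on the whole space `E`. -/
theorem norm_rpow_contDiff
    {E : Type*} [NormedAddCommGroup E] [NormedSpace ℝ E]
    (hE : UniformlySmooth E) (p : ℝ) (hp : 1 < p) :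
    ContDiff ℝ 1 fun x : E => ‖x‖ ^ p := by
  choose f hf hfx using fun x : E => exists_dual_vector'' ℝ x
  have hnorm : ∀ x, x ≠ 0 → HasFDerivAt (fun y : E => ‖y‖) (f x) x := fun x hx =>
    hE.hasFDerivAt_norm hx (hf x) (hfx x)
  have hp' : 0 < p - 1 := sub_pos.2 hp
  have hc : Continuous fun x : E => p * ‖x‖ ^ (p - 1) :=
    continuous_const.mul (continuous_norm.rpow_const fun _ => Or.inr hp'.le)
  refine contDiff_one_iff_hasFDerivAt.2 ⟨fun x => (p * ‖x‖ ^ (p - 1)) • f x, ?_, fun x => ?_⟩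
  · refine continuous_iff_continuousAt.2 fun x => ?_
    rcases eq_or_ne x 0 with rfl | hx
    · rw [ContinuousAt, norm_zero, Real.zero_rpow hp'.ne', mul_zero, zero_smul]
      refine squeeze_zero_norm (a := fun x : E => p * ‖x‖ ^ (p - 1)) (fun y => ?_) ?_
      · rw [norm_smul, Real.norm_of_nonneg (by positivity)]
        exact mul_le_of_le_one_right (by positivity) (hf y)
      · simpa [Real.zero_rpow hp'.ne'] using hc.tendsto 0
    · exact hc.continuousAt.smul (continuousAt_of_hasFDerivAt_norm hf hfx (hnorm x hx))
  · rcases eq_or_ne x 0 with rfl | hx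
    · simpa [Real.zero_rpow hp'.ne'] using hasFDerivAt_zero_norm_rpow (E := E) hp
    · exact (hnorm x hx).rpow_const (Or.inr hp.le)
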